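/- Let X be а set and let Y be a family of subsets of X which is meagre (respectively, nowhere dense) as a subset of 𝒫(X). Then the collection S of countable subsets a ⊆ X such that {y ∩ a : y ∈ Y} is meagre (respectively, nowhere dense) in 𝒫(a) is a club of [X]^{≤ℵ0}: every countable subset of X is contained in some member of S, and the union of every countable ⊆-increasing chain of members of S belongs to S. -/

import Mathlib

/-!
Statement 19 (Observation 6.11(2)): if `Y ⊆ 𝒫(X)` is meagre (respectively nowhere
dense) in the product topology on `𝒫(X) ≅ {0,1}^X`, then the collection of countable
`a ⊆ X` whose trace family `{y ∩ a : y ∈ Y}` is meagre (respectively nowhere dense)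
in `𝒫(a)` is a club of `[X]^{≤ℵ₀}`: it is unbounded, and closed under unions of
countable `⊆`-increasing chains.
-/

namespace Shelah482

/-- The product topology on the power set `𝒫(X) ≅ {0,1}^X` of a set, where `{0,1}` is
discrete: it is generated by the subbasic sets `{s | x ∈ s}` and `{s | x ∉ s}`. -/
def cantorTopology (X : Type*) : TopologicalSpace (Set X) :=
  TopologicalSpace.generateFrom
    ({U | ∃ x : X, U = { s : Set X | x ∈ s }} ∪ {U | ∃ x : X, U = { s : Set X | x ∉ s }})

/-- The trace of a family `Y` of subsets of `X` on a subset `a ⊆ X`, i.e.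
`{y ∩ a : y ∈ Y}` viewed inside `𝒫(a)`. -/
def traceFamily {X : Type*} (Y : Set (Set X)) (a : Set X) : Set (Set ↥a) :=
  (fun y : Set X => (Subtype.val ⁻¹' y : Set ↥a)) '' Y

/-- `S` is a club of `[X]^{≤ℵ₀}`: its members are countable subsets of `X`, every
countable subset of `X` is contained in a member, and `S` is closed under unions of
countable nonempty `⊆`-chains. -/
def IsClubOfCountableSubsets {X : Type*} (S : Set (Set X)) : Prop :=
  (∀ a ∈ S, a.Countable) ∧
  (∀ c : Set X, c.Countable → ∃ a ∈ S, c ⊆ a) ∧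
  (∀ C : Set (Set X), C.Countable → C.Nonempty → IsChain (· ⊆ ·) C → C ⊆ S → ⋃₀ C ∈ S)

/-- Open sets of `cantorTopology X` are those containing, with each of their points, every set
that agrees with it on some finite set of coordinates. -/
theorem isOpen_cantorTopology_iff {X : Type*} {U : Set (Set X)} :
    @IsOpen (Set X) (cantorTopology X) U ↔
      ∀ s ∈ U, ∃ F : Finset X, ∀ z : Set X, (∀ x ∈ F, (x ∈ z ↔ x ∈ s)) → z ∈ U := by
  classical
  constructor
  · intro hU
    induction hU with
    | basic V hV =>
      intro s hs
      rcases hV with ⟨x, rfl⟩ | ⟨x, rfl⟩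
      · exact ⟨{x}, fun z hz => (hz x (by simp)).2 hs⟩
      · exact ⟨{x}, fun z hz h => hs ((hz x (by simp)).1 h)⟩
    | univ => exact fun s _ => ⟨∅, fun z _ => trivial⟩
    | inter V W _ _ hV hW =>
      intro s hs
      obtain ⟨F, hF⟩ := hV s hs.1
      obtain ⟨G, hG⟩ := hW s hs.2
      exact ⟨F ∪ G, fun z hz =>
        ⟨hF z fun x hx => hz x (Finset.mem_union_left _ hx),
          hG z fun x hx => hz x (Finset.mem_union_right _ hx)⟩⟩
    | sUnion T _ hT =>
      rintro s ⟨V, hV, hs⟩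
      obtain ⟨F, hF⟩ := hT V hV s hs
      exact ⟨F, fun z hz => ⟨V, hV, hF z hz⟩⟩
  · intro h
    let _ := cantorTopology X
    rw [isOpen_iff_forall_mem_open]
    intro s hs
    obtain ⟨F, hF⟩ := h s hs
    refine ⟨⋂ x ∈ F, {z | x ∈ z ↔ x ∈ s}, fun z hz => hF z (by simpa using hz), ?_, by simp⟩
    refine isOpen_biInter_finset fun x _ => ?_
    by_cases hx : x ∈ s
    · simp only [hx, iff_true]
      exact TopologicalSpace.isOpen_generateFrom_of_mem (Or.inl ⟨x, rfl⟩)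
    · simp only [hx, iff_false]
      exact TopologicalSpace.isOpen_generateFrom_of_mem (Or.inr ⟨x, rfl⟩)

/-- The sets agreeing with `s` on a finite set of coordinates form an open set. -/
theorem isOpen_cylinder {X : Type*} (F : Finset X) (s : Set X) :
    @IsOpen (Set X) (cantorTopology X) {z : Set X | ∀ x ∈ F, (x ∈ z ↔ x ∈ s)} :=
  isOpen_cantorTopology_iff.2 fun _ ht =>
    ⟨F, fun _ hz x hx => (hz x hx).trans (ht x hx)⟩

/-- A family is nowhere dense iff every cylinder has a point with a cylinder neighbourhood
that misses the family. -/
theorem isNowhereDense_cantorTopology_iff {X : Type*} {Y : Set (Set X)} :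
    @IsNowhereDense (Set X) (cantorTopology X) Y ↔
      ∀ (F : Finset X) (s : Set X), ∃ (G : Finset X) (t : Set X),
        (∀ x ∈ F, (x ∈ t ↔ x ∈ s)) ∧ ∀ y ∈ Y, ∃ x ∈ G, ¬(x ∈ y ↔ x ∈ t) := by
  let _ := cantorTopology X
  constructor
  · intro hY F s
    have hsub : ¬{z : Set X | ∀ x ∈ F, (x ∈ z ↔ x ∈ s)} ⊆ closure Y := fun h => by
      have hs : s ∈ interior (closure Y) :=
        interior_maximal h (isOpen_cylinder F s) fun _ _ => Iff.rfl
      rw [show interior (closure Y) = ∅ from hY] at hs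
      exact hs
    obtain ⟨t, ht, htY⟩ := Set.not_subset.1 hsub
    obtain ⟨G, hG⟩ := isOpen_cantorTopology_iff.1 isClosed_closure.isOpen_compl t htY
    refine ⟨G, t, ht, fun y hy => ?_⟩
    by_contra! h
    exact hG y h (subset_closure hy)
  · intro h
    refine Set.eq_empty_of_forall_notMem fun s hs => ?_
    obtain ⟨F, hF⟩ := isOpen_cantorTopology_iff.1 isOpen_interior s hs
    obtain ⟨G, t, ht, hG⟩ := h F s
    obtain ⟨y, hy, hyY⟩ := mem_closure_iff.1 (interior_subset (hF t ht)) _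
      (isOpen_cylinder G t) fun _ _ => Iff.rfl
    obtain ⟨x, hx, hne⟩ := hG y hyY
    exact hne (hy x hx)

/-- The combinatorial form of nowhere density of the trace of `Y` on `a`, phrased with finite
subsets of `a`. -/
def NowhereDenseOn {X : Type*} (Y : Set (Set X)) (a : Set X) : Prop :=
  ∀ F : Finset X, ↑F ⊆ a → ∀ s : Set X, ∃ G : Finset X, ↑G ⊆ a ∧ ∃ t : Set X,
    (∀ x ∈ F, (x ∈ t ↔ x ∈ s)) ∧ ∀ y ∈ Y, ∃ x ∈ G, ¬(x ∈ y ↔ x ∈ t)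

theorem isNowhereDense_traceFamily_iff {X : Type*} {Y : Set (Set X)} {a : Set X} :
    @IsNowhereDense (Set ↥a) (cantorTopology ↥a) (traceFamily Y a) ↔ NowhereDenseOn Y a := by
  classical
  rw [isNowhereDense_cantorTopology_iff]
  constructor
  · intro h F hF s
    obtain ⟨G, t, ht, hG⟩ := h (F.subtype (· ∈ a)) (Subtype.val ⁻¹' s)
    refine ⟨G.map (Function.Embedding.subtype _), by simp, Subtype.val '' t, fun x hx => ?_,
      fun y hy => ?_⟩
    · simpa [hF hx] using ht ⟨x, hF hx⟩ (by simpa using hx)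
    · obtain ⟨x, hx, hne⟩ := hG _ ⟨y, hy, rfl⟩
      exact ⟨x, by simpa using hx, by simpa using hne⟩
  · intro h F s
    obtain ⟨G, hGa, t, ht, hG⟩ := h (F.map (Function.Embedding.subtype _)) (by simp)
      (Subtype.val '' s)
    refine ⟨G.subtype (· ∈ a), Subtype.val ⁻¹' t, fun x hx => ?_, ?_⟩
    · simpa using ht x (by simpa using hx)
    · rintro _ ⟨y, hy, rfl⟩
      obtain ⟨x, hx, hne⟩ := hG y hy
      exact ⟨⟨x, hGa hx⟩, by simpa using hx, hne⟩

theorem NowhereDenseOn.mono {X : Type*} {Y : Set (Set X)} {a b : Set X}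
    (h : NowhereDenseOn Y a) (hab : a ⊆ b) : NowhereDenseOn Y b := by
  classical
  intro F _ s
  obtain ⟨G, hGa, t, ht, hG⟩ := h (F.filter (· ∈ a)) (by intro x; simp) s
  refine ⟨G, hGa.trans hab, {x | if x ∈ a then x ∈ t else x ∈ s}, fun x hx => ?_, fun y hy => ?_⟩
  · by_cases hxa : x ∈ a
    · simpa [hxa] using ht x (by simp [hx, hxa])
    · simp [hxa]
  · obtain ⟨x, hx, hne⟩ := hG y hy
    exact ⟨x, hx, by simpa [hGa hx] using hne⟩

theorem nowhereDenseOn_univ {X : Type*} {Y : Set (Set X)}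
    (h : @IsNowhereDense (Set X) (cantorTopology X) Y) : NowhereDenseOn Y Set.univ := by
  intro F _ s
  obtain ⟨G, t, ht⟩ := isNowhereDense_cantorTopology_iff.1 h F s
  exact ⟨G, Set.subset_univ _, t, ht⟩

/-- A closing-off argument: nowhere density reflects to a countable set of coordinates
containing a given one. -/
theorem NowhereDenseOn.exists_countable {X : Type*} {Y : Set (Set X)}
    (h : NowhereDenseOn Y Set.univ) {c : Set X} (hc : c.Countable) :
    ∃ a : Set X, a.Countable ∧ c ⊆ a ∧ NowhereDenseOn Y a := by
  classical
  choose g _ t ht hg using fun F : Finset X => h F (Set.subset_univ _)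
  let step : Set X → Set X := fun a => a ∪ ⋃ (F : Finset a) (s : Finset a),
    (g (F.map (Function.Embedding.subtype _)) (s.map (Function.Embedding.subtype _)) : Set X)
  let A : ℕ → Set X := fun n => step^[n] c
  have hA : ∀ n, A (n + 1) = step (A n) := fun n => Function.iterate_succ_apply' step n c
  have hmono : Monotone A := monotone_nat_of_le_succ fun n => by
    rw [hA]
    exact Set.subset_union_left
  refine ⟨⋃ n, A n, Set.countable_iUnion fun n => ?_, Set.subset_iUnion A 0, ?_⟩
  · induction n with
    | zero => exact hc
    | succ n ih =>
      rw [hA]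
      have := ih.to_subtype
      exact ih.union (Set.countable_iUnion fun F => Set.countable_iUnion fun s =>
        Finset.countable_toSet _)
  · intro F hF s
    obtain ⟨n, hn⟩ := hmono.directed_le.exists_mem_subset_of_finset_subset_biUnion hF
    refine ⟨g F ↑(F.filter (· ∈ s)), ?_, t F ↑(F.filter (· ∈ s)), fun x hx => ?_, hg _ _⟩
    · refine Set.Subset.trans ?_ (Set.subset_iUnion A (n + 1))
      rw [hA]
      refine Set.Subset.trans ?_ Set.subset_union_right
      refine Set.Subset.trans ?_ (Set.subset_iUnion₂ (F.subtype (· ∈ A n))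
        ((F.filter (· ∈ s)).subtype (· ∈ A n)))
      rw [Finset.subtype_map_of_mem fun x hx => hn hx,
        Finset.subtype_map_of_mem fun x hx => hn (Finset.mem_of_mem_filter x hx)]
    · simpa [hx] using ht F ↑(F.filter (· ∈ s)) x hx

theorem isMeagre_traceFamily_iff {X : Type*} {Y : Set (Set X)} {a : Set X} :
    @IsMeagre (Set ↥a) (cantorTopology ↥a) (traceFamily Y a) ↔
      ∃ S : Set (Set (Set X)), S.Countable ∧ Y ⊆ ⋃₀ S ∧ ∀ Z ∈ S, NowhereDenseOn Z a := by
  let _ := cantorTopology ↥a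
  rw [isMeagre_iff_countable_union_isNowhereDense]
  constructor
  · rintro ⟨S, hS, hSc, hY⟩
    refine ⟨(fun T => {y : Set X | (Subtype.val ⁻¹' y : Set ↥a) ∈ T}) '' S, hSc.image _,
      fun y hy => ?_, ?_⟩
    · obtain ⟨T, hT, hyT⟩ := hY ⟨y, hy, rfl⟩
      exact ⟨_, ⟨T, hT, rfl⟩, hyT⟩
    · rintro _ ⟨T, hT, rfl⟩
      refine isNowhereDense_traceFamily_iff.1 ((hS T hT).mono ?_)
      rintro _ ⟨y, hy, rfl⟩
      exact hy
  · rintro ⟨S, hSc, hY, hS⟩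
    refine ⟨(fun Z => traceFamily Z a) '' S, ?_, hSc.image _, ?_⟩
    · rintro _ ⟨Z, hZ, rfl⟩
      exact isNowhereDense_traceFamily_iff.2 (hS Z hZ)
    · rintro _ ⟨y, hy, rfl⟩
      obtain ⟨Z, hZ, hyZ⟩ := hY hy
      exact ⟨_, ⟨Z, hZ, rfl⟩, y, hyZ, rfl⟩

/-- An upward closed and unbounded property of countable sets defines a club. -/
theorem isClubOfCountableSubsets_of_mono {X : Type*} {P : Set X → Prop}
    (hmono : ∀ a b, a ⊆ b → P a → P b)
    (hex : ∀ c : Set X, c.Countable → ∃ a : Set X, a.Countable ∧ c ⊆ a ∧ P a) :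
    IsClubOfCountableSubsets {a : Set X | a.Countable ∧ P a} := by
  refine ⟨fun a ha => ha.1, fun c hc => ?_, fun C hC hne _ hCS => ?_⟩
  · obtain ⟨a, ha, hca, hP⟩ := hex c hc
    exact ⟨a, ⟨ha, hP⟩, hca⟩
  · obtain ⟨a, ha⟩ := hne
    exact ⟨hC.sUnion fun b hb => (hCS hb).1,
      hmono a _ (Set.subset_sUnion_of_mem ha) (hCS ha).2⟩

theorem club_of_trace_meagre_or_nwd {X : Type*} (Y : Set (Set X)) :
    (@IsMeagre (Set X) (cantorTopology X) Y →
      IsClubOfCountableSubsets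
        { a : Set X | a.Countable ∧
            @IsMeagre (Set ↥a) (cantorTopology ↥a) (traceFamily Y a) }) ∧
    (@IsNowhereDense (Set X) (cantorTopology X) Y →
      IsClubOfCountableSubsets
        { a : Set X | a.Countable ∧
            @IsNowhereDense (Set ↥a) (cantorTopology ↥a) (traceFamily Y a) }) := by
  constructor
  · intro hY
    let _ := cantorTopology X
    obtain ⟨S, hS, hSc, hYS⟩ := isMeagre_iff_countable_union_isNowhereDense.1 hY
    refine isClubOfCountableSubsets_of_mono (fun a b hab ha => ?_) fun c hc => ?_
    · obtain ⟨T, hTc, hYT, hT⟩ := isMeagre_traceFamily_iff.1 ha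
      exact isMeagre_traceFamily_iff.2 ⟨T, hTc, hYT, fun Z hZ => (hT Z hZ).mono hab⟩
    · choose! A hAc _ hA using fun Z (hZ : Z ∈ S) =>
        (nowhereDenseOn_univ (hS Z hZ)).exists_countable hc
      refine ⟨c ∪ ⋃ Z ∈ S, A Z, hc.union (hSc.biUnion hAc), Set.subset_union_left,
        isMeagre_traceFamily_iff.2 ⟨S, hSc, hYS, fun Z hZ => (hA Z hZ).mono ?_⟩⟩
      exact (Set.subset_biUnion_of_mem hZ).trans Set.subset_union_right
  · intro hY
    refine isClubOfCountableSubsets_of_mono (fun a b hab ha => ?_) fun c hc => ?_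
    · exact isNowhereDense_traceFamily_iff.2 ((isNowhereDense_traceFamily_iff.1 ha).mono hab)
    · obtain ⟨a, hac, hca, ha⟩ := (nowhereDenseOn_univ hY).exists_countable hc
      exact ⟨a, hac, hca, isNowhereDense_traceFamily_iff.2 ha⟩

end Shelah482
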